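/- Let r, s > 0 with s < r, let X be exponentially distributed with rate parameter λ > 0 (so P has density f(x) = λ e^{−λx} 1_{{x>0}} on ℝ), and let (α_n)_{n≥1} be an asymptotically L^r(P)-optimal sequence of quantizers. Then: (i) for every θ ∈ (s/r, ∞), the sequence (θ·α_n)_{n≥1} is L^s(P)-rate-optimal; (ii) the function θ ↦ θ^{s+1} (∫_0^∞ f(θx)^{r/(r−s)} f(x)^{−s/(r−s)} dx)^{1−s/r} attains a unique minimum on (s/r, ∞) at θ* = (s+1)/(r+1). -/

import Mathlib

open MeasureTheory ENNReal Filter Set Metric Topology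
open scoped Classical

noncomputable section

/-- Distance from a point `x ∈ ℝ` to a finite codebook `α`. -/
def qdist1 (x : ℝ) (α : Finset ℝ) : ℝ := Metric.infDist x (α : Set ℝ)

/-- The `r`-th power `L^r` quantization error `∫ d(x,α)^r dP` of a codebook `α`. -/
def qerr1 (P : Measure ℝ) (r : ℝ) (α : Finset ℝ) : ℝ≥0∞ :=
  ∫⁻ x, ENNReal.ofReal (qdist1 x α) ^ r ∂P

/-- The optimal `n`-level `L^r` quantization error `e_{n,r}(P)`. -/
def enr1 (P : Measure ℝ) (r : ℝ) (n : ℕ) : ℝ≥0∞ :=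
  ⨅ (α : Finset ℝ) (_ : α.Nonempty) (_ : α.card ≤ n), qerr1 P r α ^ (1 / r)

/-- The constant `J_{r,1} = inf_{n ≥ 1} n^r e_{n,r}(U([0,1]))^r`. -/
def J1 (r : ℝ) : ℝ≥0∞ :=
  ⨅ (n : ℕ) (_ : 1 ≤ n), (n : ℝ≥0∞) ^ r * enr1 (volume.restrict (Icc (0 : ℝ) 1)) r n ^ r

/-- Zador's constant `Q_r(P)` on `ℝ` for `P = f·λ_1`. -/
def Q1 (f : ℝ → ℝ) (r : ℝ) : ℝ≥0∞ :=
  J1 r * (∫⁻ x, ENNReal.ofReal (f x) ^ (1 / (1 + r))) ^ (1 + r : ℝ)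

/-- The scaled codebook `θ·α = {θa : a ∈ α}`. -/
def scaleCB (θ : ℝ) (α : Finset ℝ) : Finset ℝ := α.image fun a => θ * a

/-- An `L^r(P)`-optimal sequence of `n`-quantizers on `ℝ`. -/
def OptimalSeq1 (P : Measure ℝ) (r : ℝ) (α : ℕ → Finset ℝ) : Prop :=
  ∀ n, 1 ≤ n → (α n).Nonempty ∧ (α n).card ≤ n ∧ qerr1 P r (α n) = enr1 P r n ^ r

/-- An asymptotically `L^r(P)`-optimal sequence of quantizers on `ℝ`, `P = f·λ_1`. -/
def AsympOptimalSeq1 (P : Measure ℝ) (f : ℝ → ℝ) (r : ℝ) (α : ℕ → Finset ℝ) : Prop :=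
  (∀ n, 1 ≤ n → (α n).Nonempty ∧ (α n).card ≤ n) ∧
  Tendsto (fun n : ℕ => (n : ℝ≥0∞) ^ r * qerr1 P r (α n)) atTop (𝓝 (Q1 f r))

/-- `L^s(P)`-rate-optimality of a sequence of codebooks on `ℝ`. -/
def RateOptimal1 (P : Measure ℝ) (s : ℝ) (β : ℕ → Finset ℝ) : Prop :=
  limsup (fun n : ℕ => (n : ℝ≥0∞) ^ s * qerr1 P s (β n)) atTop < ⊤

/-- The density of the exponential distribution with rate `l`. -/
def expDensity (l x : ℝ) : ℝ := if 0 < x then l * Real.exp (-(l * x)) else 0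

/-- `θ ↦ θ^{s+1} (∫_0^∞ f(θx)^{r/(r-s)} f(x)^{-s/(r-s)} dx)^{1-s/r}` for the
exponential density `f`. -/
def expG (l r s θ : ℝ) : ℝ≥0∞ :=
  ENNReal.ofReal θ ^ (s + 1 : ℝ) *
    (∫⁻ x in Ioi (0 : ℝ), ENNReal.ofReal (expDensity l (θ * x)) ^ (r / (r - s)) *
      ENNReal.ofReal (expDensity l x) ^ (-(s / (r - s)))) ^ (1 - s / r)

lemma expDensity_of_pos {l x : ℝ} (hx : 0 < x) : expDensity l x = l * Real.exp (-(l * x)) :=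
  if_pos hx

lemma expDensity_of_nonpos {l x : ℝ} (hx : x ≤ 0) : expDensity l x = 0 :=
  if_neg hx.not_gt

lemma expDensity_pos {l x : ℝ} (hl : 0 < l) (hx : 0 < x) : 0 < expDensity l x := by
  rw [expDensity_of_pos hx]
  positivity

lemma measurable_expDensity (l : ℝ) : Measurable (expDensity l) :=
  Measurable.ite measurableSet_Ioi (by fun_prop) measurable_const

lemma measurable_qdist1 (α : Finset ℝ) : Measurable fun x => qdist1 x α :=
  (Metric.continuous_infDist_pt _).measurable

lemma qdist1_scaleCB {θ : ℝ} (hθ : 0 < θ) (x : ℝ) (α : Finset ℝ) :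
    qdist1 (θ * x) (scaleCB θ α) = θ * qdist1 x α := by
  have h := infDist_smul₀ hθ.ne' (α : Set ℝ) x
  rw [Real.norm_of_nonneg hθ.le] at h
  simpa [qdist1, scaleCB, ← Set.image_smul] using h

lemma lintegral_eq_mul_lintegral_comp_mul_left {θ : ℝ} (hθ : 0 < θ) {F : ℝ → ℝ≥0∞}
    (hF : Measurable F) :
    ∫⁻ x, F x = ENNReal.ofReal θ * ∫⁻ x, F (θ * x) := by
  conv_lhs => rw [← Real.smul_map_volume_mul_left hθ.ne']
  rw [lintegral_smul_measure, lintegral_map hF (by fun_prop), abs_of_pos hθ, smul_eq_mul]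

lemma lintegral_const_mul_exp_neg_Ioi {c b : ℝ} (hc : 0 ≤ c) (hb : 0 < b) :
    ∫⁻ x in Ioi (0 : ℝ), ENNReal.ofReal (c * Real.exp (-(b * x))) = ENNReal.ofReal (c / b) := by
  have hb' : -b < 0 := by linarith
  have hi : IntegrableOn (fun x : ℝ => c * Real.exp (-b * x)) (Ioi 0) :=
    (integrableOn_exp_mul_Ioi hb' 0).const_mul c
  have h := ofReal_integral_eq_lintegral_ofReal hi
    (Eventually.of_forall fun x => mul_nonneg hc (Real.exp_pos _).le)
  rw [integral_const_mul, integral_exp_mul_Ioi hb'] at h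
  simp only [neg_mul] at h
  rw [← h]
  congr 1
  simp
  ring

lemma ofReal_const_mul_exp_rpow {c : ℝ} (hc : 0 < c) (y p : ℝ) :
    ENNReal.ofReal (c * Real.exp y) ^ p = ENNReal.ofReal (c ^ p * Real.exp (p * y)) := by
  rw [ENNReal.ofReal_rpow_of_pos (by positivity), Real.mul_rpow hc.le (Real.exp_pos _).le,
    ← Real.exp_mul, mul_comm y]

lemma expG_eq {l r s θ : ℝ} (hl : 0 < l) (hs : 0 < s) (hsr : s < r) (hθ : s / r < θ) :
    expG l r s θ =
      ENNReal.ofReal (θ ^ (s + 1) * ((r - s) / (θ * r - s)) ^ (1 - s / r)) := by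
  have hr : 0 < r := hs.trans hsr
  have hd : 0 < r - s := by linarith
  have hθ0 : 0 < θ := (div_pos hs hr).trans hθ
  have hb : 0 < θ * r - s := by rw [div_lt_iff₀ hr] at hθ; linarith
  have hint : ∫⁻ x in Ioi (0 : ℝ), ENNReal.ofReal (expDensity l (θ * x)) ^ (r / (r - s)) *
      ENNReal.ofReal (expDensity l x) ^ (-(s / (r - s))) =
      ENNReal.ofReal ((r - s) / (θ * r - s)) := by
    have hb' : 0 < l * ((θ * r - s) / (r - s)) := by positivity
    have h := lintegral_const_mul_exp_neg_Ioi hl.le hb'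
    have hq : l / (l * ((θ * r - s) / (r - s))) = (r - s) / (θ * r - s) := by
      field_simp
    rw [hq] at h
    rw [← h]
    refine setLIntegral_congr_fun measurableSet_Ioi fun x hx => ?_
    have hx : 0 < x := hx
    simp only [expDensity_of_pos hx, expDensity_of_pos (mul_pos hθ0 hx),
      ofReal_const_mul_exp_rpow hl]
    rw [← ENNReal.ofReal_mul (by positivity), mul_mul_mul_comm, ← Real.rpow_add hl,
      ← Real.exp_add]
    have h1 : r / (r - s) + -(s / (r - s)) = 1 := by field_simp; ring
    rw [h1, Real.rpow_one]
    congr 3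
    field_simp
    ring
  rw [expG, hint, ENNReal.ofReal_rpow_of_pos hθ0, ENNReal.ofReal_rpow_of_pos (by positivity),
    ← ENNReal.ofReal_mul (by positivity)]

/-- Hölder's inequality bounds the `L^s` error of the dilated codebook by a power of the `L^r`
error of the original one. -/
lemma qerr1_scaleCB_le {l r s θ : ℝ} (hl : 0 < l) (hs : 0 < s) (hsr : s < r) (hθ : 0 < θ)
    (α : Finset ℝ) :
    qerr1 (volume.withDensity fun x => ENNReal.ofReal (expDensity l x)) s (scaleCB θ α) ≤
      qerr1 (volume.withDensity fun x => ENNReal.ofReal (expDensity l x)) r α ^ (s / r) *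
        expG l r s θ := by
  have hr : 0 < r := hs.trans hsr
  have hd : 0 < r - s := by linarith
  have hf : Measurable fun x => ENNReal.ofReal (expDensity l x) :=
    (measurable_expDensity l).ennreal_ofReal
  have hD (p : ℝ) (β : Finset ℝ) : Measurable fun x => ENNReal.ofReal (qdist1 x β) ^ p :=
    (measurable_qdist1 β).ennreal_ofReal.pow_const p
  have hfθ : Measurable fun x => ENNReal.ofReal (expDensity l (θ * x)) :=
    hf.comp (measurable_const_mul θ)
  set u : ℝ → ℝ≥0∞ := fun x =>
    (ENNReal.ofReal (expDensity l x) * ENNReal.ofReal (qdist1 x α) ^ r) ^ (s / r) with hu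
  set v : ℝ → ℝ≥0∞ := fun x => ENNReal.ofReal (expDensity l (θ * x)) *
    ENNReal.ofReal (expDensity l x) ^ (-(s / r)) with hv
  have hum : Measurable u := (hf.mul (hD r α)).pow_const _
  have hvm : Measurable v := hfθ.mul (hf.pow_const _)
  have hpq : (r / s).HolderConjugate (r / (r - s)) := by
    rw [Real.holderConjugate_iff]
    refine ⟨(one_lt_div hs).2 hsr, ?_⟩
    field_simp
    ring
  have hdil : ∫⁻ x, ENNReal.ofReal (expDensity l x) * ENNReal.ofReal (qdist1 x (scaleCB θ α)) ^ s =
      ENNReal.ofReal θ ^ (s + 1) * ∫⁻ x in Ioi (0 : ℝ), (u * v) x := by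
    rw [lintegral_eq_mul_lintegral_comp_mul_left hθ (F := fun x => ENNReal.ofReal (expDensity l x) *
        ENNReal.ofReal (qdist1 x (scaleCB θ α)) ^ s) (hf.mul (hD s _)),
      ENNReal.rpow_add_of_nonneg _ _ hs.le zero_le_one, ENNReal.rpow_one, mul_comm (_ ^ s),
      mul_assoc, ← lintegral_const_mul _ (hum.mul hvm), ← lintegral_indicator measurableSet_Ioi]
    congr 2
    funext x
    by_cases hx : 0 < x
    · have hfx := expDensity_pos hl hx
      have h0 : ENNReal.ofReal (expDensity l x) ≠ 0 := by simpa using hfx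
      have h1 : ENNReal.ofReal (expDensity l x) ^ (s / r) *
          ENNReal.ofReal (expDensity l x) ^ (-(s / r)) = 1 := by
        rw [← ENNReal.rpow_add _ _ h0 ENNReal.ofReal_ne_top]
        simp
      rw [indicator_of_mem (show x ∈ Ioi (0 : ℝ) from hx), qdist1_scaleCB hθ,
        ENNReal.ofReal_mul hθ.le, ENNReal.mul_rpow_of_nonneg _ _ hs.le, Pi.mul_apply, hu, hv]
      simp only
      rw [ENNReal.mul_rpow_of_nonneg _ _ (by positivity), ← ENNReal.rpow_mul,
        mul_div_cancel₀ _ hr.ne']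
      calc _ = ENNReal.ofReal θ ^ s * (1 * ENNReal.ofReal (qdist1 x α) ^ s *
            ENNReal.ofReal (expDensity l (θ * x))) := by ring
        _ = _ := by rw [← h1]; ring
    · rw [indicator_of_notMem (show x ∉ Ioi (0 : ℝ) from hx), expDensity_of_nonpos
        (mul_nonpos_of_nonneg_of_nonpos hθ.le (not_lt.1 hx))]
      simp
  have hU : ∫⁻ x in Ioi (0 : ℝ), u x ^ (r / s) ≤
      ∫⁻ x, ENNReal.ofReal (expDensity l x) * ENNReal.ofReal (qdist1 x α) ^ r := by
    refine (lintegral_mono fun x => ?_).trans (setLIntegral_le_lintegral _ _)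
    rw [hu]
    simp only
    rw [← ENNReal.rpow_mul, div_mul_div_cancel₀ hr.ne', div_self hs.ne', ENNReal.rpow_one]
  have hV : ∫⁻ x in Ioi (0 : ℝ), v x ^ (r / (r - s)) =
      ∫⁻ x in Ioi (0 : ℝ), ENNReal.ofReal (expDensity l (θ * x)) ^ (r / (r - s)) *
        ENNReal.ofReal (expDensity l x) ^ (-(s / (r - s))) := by
    refine lintegral_congr fun x => ?_
    rw [hv]
    simp only
    rw [ENNReal.mul_rpow_of_nonneg _ _ (by positivity), ← ENNReal.rpow_mul]
    congr 2
    field_simp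
  have hH := ENNReal.lintegral_mul_le_Lp_mul_Lq (volume.restrict (Ioi (0 : ℝ))) hpq
    hum.aemeasurable hvm.aemeasurable
  rw [hV, one_div_div, one_div_div, sub_div, div_self hr.ne'] at hH
  have hq (p : ℝ) (β : Finset ℝ) :
      qerr1 (volume.withDensity fun x => ENNReal.ofReal (expDensity l x)) p β =
        ∫⁻ x, ENNReal.ofReal (expDensity l x) * ENNReal.ofReal (qdist1 x β) ^ p :=
    lintegral_withDensity_eq_lintegral_mul _ hf (hD p β)
  rw [hq, hq, hdil, expG, mul_left_comm]
  gcongr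
  exact hH.trans (by gcongr)

lemma J1_ne_top {r : ℝ} (hr : 0 < r) : J1 r ≠ ⊤ := by
  have hq : qerr1 (volume.restrict (Icc (0 : ℝ) 1)) r {0} ≤ 1 := by
    calc qerr1 (volume.restrict (Icc (0 : ℝ) 1)) r {0}
        ≤ ∫⁻ _ in Icc (0 : ℝ) 1, 1 := by
          refine setLIntegral_mono measurable_const fun x hx => ENNReal.rpow_le_one ?_ hr.le
          simpa [qdist1, abs_of_nonneg hx.1] using hx.2
      _ = 1 := by simp
  have he : enr1 (volume.restrict (Icc (0 : ℝ) 1)) r 1 ≤ 1 :=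
    (iInf₂_le_of_le {0} (Finset.singleton_nonempty _) (iInf_le _ (by simp))).trans
      (ENNReal.rpow_le_one hq (by positivity))
  have hJ : J1 r ≤ 1 := by
    refine (iInf₂_le 1 le_rfl).trans ?_
    simpa using ENNReal.rpow_le_one he hr.le
  exact (hJ.trans_lt one_lt_top).ne

lemma Q1_expDensity_ne_top {l r : ℝ} (hl : 0 < l) (hr : 0 < r) : Q1 (expDensity l) r ≠ ⊤ := by
  refine ENNReal.mul_ne_top (J1_ne_top hr) (ENNReal.rpow_ne_top_of_nonneg (by positivity) ?_)
  have h : ∫⁻ x, ENNReal.ofReal (expDensity l x) ^ (1 / (1 + r)) =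
      ∫⁻ x in Ioi (0 : ℝ),
        ENNReal.ofReal (l ^ (1 / (1 + r)) * Real.exp (-(l / (1 + r) * x))) := by
    rw [← lintegral_indicator measurableSet_Ioi]
    refine lintegral_congr fun x => ?_
    by_cases hx : 0 < x
    · rw [indicator_of_mem (show x ∈ Ioi (0 : ℝ) from hx), expDensity_of_pos hx,
        ofReal_const_mul_exp_rpow hl]
      congr 3
      ring
    · rw [indicator_of_notMem (show x ∉ Ioi (0 : ℝ) from hx), expDensity_of_nonpos (not_lt.1 hx),
        ENNReal.ofReal_zero, ENNReal.zero_rpow_of_pos (by positivity)]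
  rw [h, lintegral_const_mul_exp_neg_Ioi (by positivity) (by positivity)]
  exact ENNReal.ofReal_ne_top

/-- The strict Bernoulli inequality in the form `(1 + (p / a) (t - 1)) ^ a < t ^ p`. -/
lemma one_add_div_mul_rpow_lt {a p t : ℝ} (ha : 0 < a) (hap : a < p) (ht : t ≠ 1)
    (hu : 0 < 1 + p / a * (t - 1)) : (1 + p / a * (t - 1)) ^ a < t ^ p := by
  have hp : 0 < p := ha.trans hap
  have h := rpow_one_add_lt_one_add_mul_self (s := p / a * (t - 1)) (p := a / p)
    (by linarith) (mul_ne_zero (by positivity) (sub_ne_zero.2 ht)) (by positivity)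
    ((div_lt_one hp).2 hap)
  have ht' : 1 + a / p * (p / a * (t - 1)) = t := by field_simp; ring
  rw [ht'] at h
  have h2 := Real.rpow_lt_rpow (by positivity) h hp
  rwa [← Real.rpow_mul hu.le, div_mul_cancel₀ _ hp.ne'] at h2

lemma expG_lt_expG {l r s θ : ℝ} (hl : 0 < l) (hs : 0 < s) (hsr : s < r) (hθ : s / r < θ)
    (hne : θ ≠ (s + 1) / (r + 1)) : expG l r s ((s + 1) / (r + 1)) < expG l r s θ := by
  have hr : 0 < r := hs.trans hsr
  have hd : 0 < r - s := by linarith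
  have hθ0 : 0 < θ := (div_pos hs hr).trans hθ
  have hb : 0 < θ * r - s := by rw [div_lt_iff₀ hr] at hθ; linarith
  have hstar : s / r < (s + 1) / (r + 1) := by
    rw [div_lt_div_iff₀ hr (by positivity)]
    linarith
  have hbs : (s + 1) / (r + 1) * r - s = (r - s) / (r + 1) := by field_simp; ring
  have ha : 0 < 1 - s / r := by rw [sub_pos, div_lt_one hr]; exact hsr
  have hap : 1 - s / r < s + 1 := by linarith [div_pos hs hr]
  have hu : 1 + (s + 1) / (1 - s / r) * (θ / ((s + 1) / (r + 1)) - 1) =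
      (θ * r - s) / ((r - s) / (r + 1)) := by
    have : 1 - s / r = (r - s) / r := by field_simp
    rw [this]
    field_simp
    ring
  have hB := one_add_div_mul_rpow_lt (t := θ / ((s + 1) / (r + 1))) ha hap
    (by rwa [ne_eq, div_eq_one_iff_eq (by positivity)]) (by rw [hu]; positivity)
  rw [hu, Real.div_rpow hb.le (by positivity), Real.div_rpow hθ0.le (by positivity),
    div_lt_div_iff₀ (by positivity) (by positivity)] at hB
  rw [expG_eq hl hs hsr hθ, expG_eq hl hs hsr hstar, hbs,
    ENNReal.ofReal_lt_ofReal_iff (by positivity), Real.div_rpow hd.le (by positivity),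
    Real.div_rpow hd.le hb.le, ← mul_div_assoc, ← mul_div_assoc,
    div_lt_div_iff₀ (by positivity) (by positivity)]
  have hc : 0 < (r - s) ^ (1 - s / r) := by positivity
  nlinarith [mul_lt_mul_of_pos_right hB hc]

/-- **Proposition 5.4 (b), exponential distribution, `s < r`.**
Let `s < r`, `X ~ E(λ)`, `(α_n)` asymptotically `L^r(P)`-optimal.  Then
(i) for every `θ ∈ (s/r, ∞)` the sequence `(θ·α_n)` is `L^s(P)`-rate-optimal;
(ii) `θ* = (s+1)/(r+1)` is the unique minimizer of
`θ ↦ θ^{s+1} (∫_0^∞ f(θx)^{r/(r-s)} f(x)^{-s/(r-s)} dx)^{1-s/r}` on `(s/r, ∞)`. -/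
theorem stmt_16 (r s : ℝ) (hs : 0 < s) (hsr : s < r)
    (l : ℝ) (hl : 0 < l)
    (P : Measure ℝ)
    (hP : P = volume.withDensity fun x => ENNReal.ofReal (expDensity l x))
    (α : ℕ → Finset ℝ) (hα : AsympOptimalSeq1 P (expDensity l) r α) :
    (∀ θ : ℝ, s / r < θ → RateOptimal1 P s (fun n => scaleCB θ (α n))) ∧
    (∀ θ : ℝ, s / r < θ →
      expG l r s ((s + 1) / (r + 1)) ≤ expG l r s θ ∧
      (expG l r s θ = expG l r s ((s + 1) / (r + 1)) → θ = (s + 1) / (r + 1))) := by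
  have hr : 0 < r := hs.trans hsr
  subst hP
  refine ⟨fun θ hθ => ?_, fun θ hθ => ?_⟩
  · have hlim := ENNReal.Tendsto.mul_const
      ((ENNReal.continuous_rpow_const (y := s / r)).continuousAt.tendsto.comp hα.2)
      (b := expG l r s θ) (Or.inr (by rw [expG_eq hl hs hsr hθ]; exact ENNReal.ofReal_ne_top))
    refine lt_of_le_of_lt ((limsup_le_limsup (Eventually.of_forall fun n => ?_)).trans
      hlim.limsup_eq.le) (ENNReal.mul_lt_top (ENNReal.rpow_lt_top_of_nonneg (by positivity)
        (Q1_expDensity_ne_top hl hr)) (by rw [expG_eq hl hs hsr hθ]; exact ENNReal.ofReal_lt_top))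
    simp only [Function.comp_apply]
    rw [ENNReal.mul_rpow_of_nonneg _ _ (by positivity), ← ENNReal.rpow_mul,
      mul_div_cancel₀ _ hr.ne', mul_assoc]
    gcongr
    exact qerr1_scaleCB_le hl hs hsr ((div_pos hs hr).trans hθ) (α n)
  · by_cases hne : θ = (s + 1) / (r + 1)
    · exact ⟨by rw [hne], fun _ => hne⟩
    · have h := expG_lt_expG hl hs hsr hθ hne
      exact ⟨h.le, fun heq => absurd heq h.ne'⟩
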